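/- Let x, y ∈ M_n(ℂ) be positive semidefinite, let t ∈ [1/2, 1], and let |||·||| be any unitarily invariant norm on M_n(ℂ). Set b_t = x^t y^{1-t} + y^t x^{1-t} and f_t = y^{1-t} x^{2t-1} y^{1-t} + x^{1-t} y^{2t-1} x^{1-t}. Then |||b_t||| ≤ |||x+y|||^{1/2} · |||f_t|||^{1/2}. -/

import Mathlib

open scoped Matrix ComplexOrder

/-- The real power `A^s` of a positive semidefinite matrix, defined via the spectral
decomposition (equivalently, the continuous functional calculus), with the convention
`A^0 = 1`.  (If `A` is not Hermitian we return the junk value `0`.) -/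
noncomputable def psdPow {N : ℕ} (A : Matrix (Fin N) (Fin N) ℂ) (s : ℝ) :
    Matrix (Fin N) (Fin N) ℂ :=
  if hA : A.IsHermitian then
    (Matrix.IsHermitian.eigenvectorUnitary hA : Matrix (Fin N) (Fin N) ℂ) *
      Matrix.diagonal (fun i => ((hA.eigenvalues i ^ s : ℝ) : ℂ)) *
      (Matrix.IsHermitian.eigenvectorUnitary hA : Matrix (Fin N) (Fin N) ℂ)ᴴ
  else 0

/-- Singular value decomposition of a square complex matrix. -/
theorem Matrix.exists_unitary_diagonal {n : Type*} [Fintype n] [LinearOrder n]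
    [LocallyFiniteOrderBot n] [WellFoundedLT n] (X : Matrix n n ℂ) :
    ∃ U ∈ unitaryGroup n ℂ, ∃ V ∈ unitaryGroup n ℂ, ∃ d : n → ℝ,
      Uᴴ * X * V = diagonal fun i => (d i : ℂ) := by
  have hH := (posSemidef_conjTranspose_mul_self X).isHermitian
  let V : Matrix n n ℂ := hH.eigenvectorUnitary
  have hV : V ∈ unitaryGroup n ℂ := hH.eigenvectorUnitary.2
  have hV' : Vᴴ * V = 1 := mem_unitaryGroup_iff'.1 hV
  have hXV : (X * V)ᴴ * (X * V) = diagonal fun i => (hH.eigenvalues i : ℂ) := by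
    have h := hH.spectral_theorem
    rw [Unitary.conjStarAlgAut_apply] at h
    change Xᴴ * X = V * _ * Vᴴ at h
    rw [conjTranspose_mul, ← Matrix.mul_assoc, Matrix.mul_assoc Vᴴ]
    refine (congrArg (fun Z => Vᴴ * Z * V) h).trans ?_
    simp only [Matrix.mul_assoc, hV', Matrix.mul_one]
    rw [← Matrix.mul_assoc, hV', Matrix.one_mul]
    rfl
  let f : n → EuclideanSpace ℂ n := fun i => WithLp.toLp 2 fun j => (X * V) j i
  have hf : Pairwise fun i j => inner ℂ (f i) (f j) = 0 := by
    intro i j hij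
    have := congrFun (congrFun hXV i) j
    rw [diagonal_apply_ne _ hij, mul_apply] at this
    simpa [f, PiLp.inner_apply, mul_comm] using this
  let b := InnerProductSpace.gramSchmidtOrthonormalBasis (𝕜 := ℂ) finrank_euclideanSpace f
  have hb : ∀ i, f i = (‖f i‖ : ℂ) • b i := by
    intro i
    by_cases h : f i = 0
    · simp [h]
    · have hi : (‖f i‖ : ℂ) ≠ 0 := Complex.ofReal_ne_zero.2 (norm_ne_zero_iff.2 h)
      rw [show b i = (‖f i‖ : ℂ)⁻¹ • f i from
        InnerProductSpace.gramSchmidtOrthonormalBasis_apply_of_orthogonal _ hf h, smul_smul,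
        mul_inv_cancel₀ hi, one_smul]
  let U : Matrix n n ℂ := (EuclideanSpace.basisFun n ℂ).toBasis.toMatrix b
  have hU : U ∈ unitaryGroup n ℂ :=
    (EuclideanSpace.basisFun n ℂ).toMatrix_orthonormalBasis_mem_unitary b
  have hXU : X * V = U * diagonal fun i => (‖f i‖ : ℂ) := by
    ext j i
    rw [mul_diagonal]
    have := congrArg (fun v : EuclideanSpace ℂ n => v j) (hb i)
    simpa [f, U, Module.Basis.toMatrix_apply, mul_comm] using this
  refine ⟨U, hU, V, hV, fun i => ‖f i‖, ?_⟩
  rw [Matrix.mul_assoc, hXU, ← Matrix.mul_assoc, show Uᴴ * U = 1 from mem_unitaryGroup_iff'.1 hU,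
    Matrix.one_mul]

theorem psdPow_conjTranspose {n : ℕ} (A : Matrix (Fin n) (Fin n) ℂ) (s : ℝ) :
    (psdPow A s)ᴴ = psdPow A s := by
  unfold psdPow
  split_ifs with hA
  · rw [Matrix.conjTranspose_mul, Matrix.conjTranspose_mul, Matrix.conjTranspose_conjTranspose,
      Matrix.diagonal_conjTranspose, ← Matrix.mul_assoc]
    congr 3
    ext i
    simp
  · simp

theorem psdPow_mul_psdPow {n : ℕ} {A : Matrix (Fin n) (Fin n) ℂ} (hA : A.PosSemidef) {s t : ℝ}
    (hs : 0 ≤ s) (ht : 0 ≤ t) : psdPow A s * psdPow A t = psdPow A (s + t) := by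
  have hU : (hA.isHermitian.eigenvectorUnitary : Matrix (Fin n) (Fin n) ℂ)ᴴ *
      hA.isHermitian.eigenvectorUnitary = 1 :=
    Matrix.mem_unitaryGroup_iff'.1 hA.isHermitian.eigenvectorUnitary.2
  simp only [psdPow, dif_pos hA.isHermitian, Matrix.mul_assoc]
  rw [← Matrix.mul_assoc _ᴴ, hU, Matrix.one_mul, ← Matrix.mul_assoc (Matrix.diagonal _),
    Matrix.diagonal_mul_diagonal]
  simp_rw [Real.rpow_add_of_nonneg (hA.eigenvalues_nonneg _) hs ht, Complex.ofReal_mul]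

theorem psdPow_one {n : ℕ} {A : Matrix (Fin n) (Fin n) ℂ} (hA : A.IsHermitian) :
    psdPow A 1 = A := by
  have h := hA.spectral_theorem
  rw [Unitary.conjStarAlgAut_apply] at h
  conv_rhs => rw [h]
  simp only [psdPow, dif_pos hA, Real.rpow_one]
  rfl

/-- A unitarily invariant norm on the `n × n` complex matrices. -/
structure IsUnitarilyInvariantNorm {n : ℕ} (N : Matrix (Fin n) (Fin n) ℂ → ℝ) : Prop where
  add_le : ∀ A B, N (A + B) ≤ N A + N B
  smul : ∀ (c : ℂ) A, N (c • A) = ‖c‖ * N A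
  eq_zero_iff : ∀ A, N A = 0 ↔ A = 0
  unitary_mul_mul : ∀ (A U V : Matrix (Fin n) (Fin n) ℂ),
    U ∈ Matrix.unitaryGroup (Fin n) ℂ → V ∈ Matrix.unitaryGroup (Fin n) ℂ → N (U * A * V) = N A

namespace IsUnitarilyInvariantNorm

open Matrix

variable {n : ℕ} {N : Matrix (Fin n) (Fin n) ℂ → ℝ}

theorem nonneg (hN : IsUnitarilyInvariantNorm N) (A : Matrix (Fin n) (Fin n) ℂ) : 0 ≤ N A := by
  have h := hN.add_le A ((-1 : ℂ) • A)
  rw [hN.smul, neg_one_smul, add_neg_cancel, (hN.eq_zero_iff 0).2 rfl] at h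
  norm_num at h
  exact h

theorem sum_le (hN : IsUnitarilyInvariantNorm N) {ι : Type*} (s : Finset ι)
    (A : ι → Matrix (Fin n) (Fin n) ℂ) : N (∑ i ∈ s, A i) ≤ ∑ i ∈ s, N (A i) :=
  Finset.le_sum_of_subadditive N ((hN.eq_zero_iff 0).2 rfl).le hN.add_le s A

theorem convexOn (hN : IsUnitarilyInvariantNorm N) : ConvexOn ℝ Set.univ N := by
  have hs : ∀ (a : ℝ) (A : Matrix (Fin n) (Fin n) ℂ), 0 ≤ a → N (a • A) = a * N A := by
    intro a A ha
    rw [← Complex.coe_smul, hN.smul, Complex.norm_of_nonneg ha]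
  refine ⟨convex_univ, fun A _ B _ a b ha hb _ => (hN.add_le _ _).trans_eq ?_⟩
  rw [hs a A ha, hs b B hb, smul_eq_mul, smul_eq_mul]

theorem diagonal_mem_unitaryGroup {e : Fin n → ℝ} (he : ∀ i, e i = 1 ∨ e i = -1) :
    diagonal (fun i => (e i : ℂ)) ∈ unitaryGroup (Fin n) ℂ := by
  rw [mem_unitaryGroup_iff, star_eq_conjTranspose, diagonal_conjTranspose, diagonal_mul_diagonal,
    ← diagonal_one]
  congr 1
  ext i
  rcases he i with h | h <;> simp [h]

theorem diagonal_mul_le (hN : IsUnitarilyInvariantNorm N) {r : Fin n → ℝ}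
    (hr : ∀ i, r i ∈ Set.Icc (-1) 1) (A : Matrix (Fin n) (Fin n) ℂ) :
    N (diagonal (fun i => (r i : ℂ)) * A) ≤ N A := by
  let L : (Fin n → ℝ) →ₗ[ℝ] Matrix (Fin n) (Fin n) ℂ :=
    { toFun := fun r => diagonal (fun i => (r i : ℂ)) * A
      map_add' := fun r s => by
        ext i j
        simp [diagonal_mul, add_mul]
      map_smul' := fun c r => by
        ext i j
        simp [diagonal_mul, mul_assoc] }
  have hmem : r ∈ convexHull ℝ (Set.univ.pi fun _ : Fin n => ({-1, 1} : Set ℝ)) := by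
    rw [convexHull_pi]
    intro i _
    rw [convexHull_pair, segment_eq_Icc (by norm_num)]
    exact hr i
  obtain ⟨e, he, hle⟩ :=
    (hN.convexOn.comp_linearMap L).exists_ge_of_mem_convexHull (Set.subset_univ _) hmem
  have hu : diagonal (fun i => (e i : ℂ)) ∈ unitaryGroup (Fin n) ℂ :=
    diagonal_mem_unitaryGroup fun i => by simpa [or_comm] using he i trivial
  refine hle.trans_eq ?_
  simpa [L] using hN.unitary_mul_mul A _ 1 hu (one_mem _)

theorem sum_signs_mul (i j : Fin n) (hij : i ≠ j) :
    ∑ e : Fin n → ℤˣ, (((e i : ℤ) : ℂ) * ((e j : ℤ) : ℂ)) = 0 := by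
  have h := Equiv.sum_comp (Equiv.mulLeft (Pi.mulSingle i (-1) : Fin n → ℤˣ))
    fun e : Fin n → ℤˣ => (((e i : ℤ) : ℂ) * ((e j : ℤ) : ℂ))
  simp [hij.symm] at h
  exact self_eq_neg.1 h.symm

/-- Pinching to the diagonal does not increase a unitarily invariant norm. -/
theorem diagonal_diag_le (hN : IsUnitarilyInvariantNorm N) (A : Matrix (Fin n) (Fin n) ℂ) :
    N (diagonal A.diag) ≤ N A := by
  let S : (Fin n → ℤˣ) → Matrix (Fin n) (Fin n) ℂ :=
    fun e => diagonal fun i => (((e i : ℤ) : ℝ) : ℂ)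
  have hS : ∀ e, S e ∈ unitaryGroup (Fin n) ℂ := fun e => diagonal_mem_unitaryGroup fun i => by
    rcases Int.units_eq_one_or (e i) with h | h <;> simp [h]
  let c : ℕ := Fintype.card (Fin n → ℤˣ)
  have hc : 0 < c := Fintype.card_pos
  have havg : ∑ e, S e * A * S e = (c : ℂ) • diagonal A.diag := by
    ext i j
    have hterm : ∀ e : Fin n → ℤˣ,
        (S e * A * S e) i j = (((e i : ℤ) : ℂ) * ((e j : ℤ) : ℂ)) * A i j := by
      intro e
      simp only [S, mul_diagonal, diagonal_mul, Complex.ofReal_intCast]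
      ring
    rw [Matrix.sum_apply, Finset.sum_congr rfl fun e _ => hterm e, ← Finset.sum_mul]
    by_cases hij : i = j
    · subst hij
      have hone : ∀ e : Fin n → ℤˣ, (((e i : ℤ) : ℂ) * ((e i : ℤ) : ℂ)) = 1 := by
        intro e
        rcases Int.units_eq_one_or (e i) with h | h <;> simp [h]
      rw [Finset.sum_congr rfl fun e _ => hone e]
      simp [c]
    · rw [sum_signs_mul i j hij]
      simp [diagonal_apply_ne _ hij]
  have h := hN.sum_le Finset.univ fun e => S e * A * S e
  rw [havg, hN.smul, Finset.sum_congr rfl fun e _ => hN.unitary_mul_mul A _ _ (hS e) (hS e)] at h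
  rw [Finset.sum_const, Finset.card_univ, nsmul_eq_mul, Complex.norm_natCast] at h
  exact le_of_mul_le_mul_left h (by exact_mod_cast hc)

theorem diagonal_le_of_abs_le (hN : IsUnitarilyInvariantNorm N) {d m : Fin n → ℝ}
    (hdm : ∀ i, |d i| ≤ m i) :
    N (diagonal fun i => (d i : ℂ)) ≤ N (diagonal fun i => (m i : ℂ)) := by
  have hm : ∀ i, 0 ≤ m i := fun i => (abs_nonneg _).trans (hdm i)
  have hr : ∀ i, d i / m i ∈ Set.Icc (-1 : ℝ) 1 := fun i => by
    rw [Set.mem_Icc, ← abs_le, abs_div, abs_of_nonneg (hm i)]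
    exact div_le_one_of_le₀ (hdm i) (hm i)
  convert hN.diagonal_mul_le hr (diagonal fun i => (m i : ℂ)) using 2
  rw [diagonal_mul_diagonal]
  congr 1
  ext i
  rcases (hm i).eq_or_lt with h | h
  · have : d i = 0 := abs_nonpos_iff.1 (h ▸ hdm i)
    simp [this]
  · rw [← Complex.ofReal_mul, div_mul_cancel₀ _ h.ne']

theorem conjTranspose_mul_le_half {m : Type*} [Fintype m] (hN : IsUnitarilyInvariantNorm N)
    (A B : Matrix m (Fin n) ℂ) : N (Aᴴ * B) ≤ (N (Aᴴ * A) + N (Bᴴ * B)) / 2 := by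
  obtain ⟨U, hU, V, hV, d, hd⟩ := exists_unitary_diagonal (Aᴴ * B)
  have hU' : Uᴴ ∈ unitaryGroup (Fin n) ℂ := Unitary.star_mem hU
  have hV' : Vᴴ ∈ unitaryGroup (Fin n) ℂ := Unitary.star_mem hV
  let M : Matrix (Fin n) (Fin n) ℂ :=
    ((1 / 2 : ℝ) : ℂ) • (Uᴴ * (Aᴴ * A) * U + Vᴴ * (Bᴴ * B) * V)
  let a : Fin n → m → ℂ := fun i k => (A * U) k i
  let b : Fin n → m → ℂ := fun i k => (B * V) k i
  let p : Fin n → ℝ := fun i => (1 / 2) * ∑ k, (‖a i k‖ ^ 2 + ‖b i k‖ ^ 2)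
  have hM : M.diag = fun i => (p i : ℂ) := by
    have hA : Uᴴ * (Aᴴ * A) * U = (A * U)ᴴ * (A * U) := by
      simp only [conjTranspose_mul, Matrix.mul_assoc]
    have hB : Vᴴ * (Bᴴ * B) * V = (B * V)ᴴ * (B * V) := by
      simp only [conjTranspose_mul, Matrix.mul_assoc]
    ext i
    have hsum : ∀ C : Matrix m (Fin n) ℂ, (Cᴴ * C) i i = ((∑ k, ‖C k i‖ ^ 2 : ℝ) : ℂ) := by
      intro C
      rw [mul_apply, Complex.ofReal_sum]
      refine Finset.sum_congr rfl fun k _ => ?_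
      rw [Complex.ofReal_pow]
      exact Complex.conj_mul' _
    simp only [M, hA, hB, diag_apply, Matrix.smul_apply, Matrix.add_apply, hsum, p,
      Finset.sum_add_distrib, smul_eq_mul, Complex.ofReal_mul, Complex.ofReal_add, a, b]
  have hdp : ∀ i, |d i| ≤ p i := by
    intro i
    have hdi : (d i : ℂ) = ∑ k, star (a i k) * b i k := by
      have h : Uᴴ * (Aᴴ * B) * V = (A * U)ᴴ * (B * V) := by
        simp only [conjTranspose_mul, Matrix.mul_assoc]
      rw [h] at hd
      have hi := congrFun (congrFun hd i) i
      rw [diagonal_apply_eq, mul_apply] at hi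
      exact hi.symm
    rw [← Real.norm_eq_abs, ← Complex.norm_real, hdi]
    refine (norm_sum_le _ _).trans ?_
    simp only [p, Finset.mul_sum]
    refine Finset.sum_le_sum fun k _ => ?_
    rw [norm_mul, norm_star]
    nlinarith [sq_nonneg (‖a i k‖ - ‖b i k‖)]
  calc N (Aᴴ * B) = N (diagonal fun i => (d i : ℂ)) := by
        rw [← hd, hN.unitary_mul_mul _ _ _ hU' hV]
    _ ≤ N (diagonal M.diag) := hM ▸ hN.diagonal_le_of_abs_le hdp
    _ ≤ N M := hN.diagonal_diag_le M
    _ ≤ (1 / 2) * (N (Uᴴ * (Aᴴ * A) * U) + N (Vᴴ * (Bᴴ * B) * V)) := by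
        rw [hN.smul, Complex.norm_of_nonneg (by norm_num)]
        exact mul_le_mul_of_nonneg_left (hN.add_le _ _) (by norm_num)
    _ = (N (Aᴴ * A) + N (Bᴴ * B)) / 2 := by
        rw [hN.unitary_mul_mul _ _ _ hU' hU, hN.unitary_mul_mul _ _ _ hV' hV]
        ring

/-- The Cauchy–Schwarz inequality for unitarily invariant norms. -/
theorem conjTranspose_mul_le_sqrt {m : Type*} [Fintype m] (hN : IsUnitarilyInvariantNorm N)
    (A B : Matrix m (Fin n) ℂ) : N (Aᴴ * B) ≤ √(N (Aᴴ * A)) * √(N (Bᴴ * B)) := by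
  have h0 : N 0 = 0 := (hN.eq_zero_iff 0).2 rfl
  rcases (hN.nonneg (Aᴴ * A)).eq_or_lt with ha | ha
  · have hA : A = 0 := conjTranspose_mul_self_eq_zero.1 ((hN.eq_zero_iff _).1 ha.symm)
    simp [hA, h0]
  rcases (hN.nonneg (Bᴴ * B)).eq_or_lt with hb | hb
  · have hB : B = 0 := conjTranspose_mul_self_eq_zero.1 ((hN.eq_zero_iff _).1 hb.symm)
    simp [hB, h0]
  have hsmul : ∀ (r s : ℝ) (C D : Matrix m (Fin n) ℂ), 0 ≤ r → 0 ≤ s →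
      N (((r : ℂ) • C)ᴴ * ((s : ℂ) • D)) = r * s * N (Cᴴ * D) := by
    intro r s C D hr hs
    rw [conjTranspose_smul, Matrix.smul_mul, Matrix.mul_smul, smul_smul, hN.smul, norm_mul,
      norm_star, Complex.norm_of_nonneg hr, Complex.norm_of_nonneg hs]
  set α := √(N (Aᴴ * A))
  set β := √(N (Bᴴ * B))
  have hα : 0 < α := Real.sqrt_pos.2 ha
  have hβ : 0 < β := Real.sqrt_pos.2 hb
  have h := hN.conjTranspose_mul_le_half ((β : ℂ) • A) ((α : ℂ) • B)
  rw [hsmul _ _ _ _ hβ.le hα.le, hsmul _ _ _ _ hβ.le hβ.le, hsmul _ _ _ _ hα.le hα.le,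
    ← Real.mul_self_sqrt ha.le, ← Real.mul_self_sqrt hb.le] at h
  refine le_of_mul_le_mul_left (h.trans_eq ?_) (mul_pos hβ hα)
  ring

end IsUnitarilyInvariantNorm

theorem stmt7 {n : ℕ} (x y : Matrix (Fin n) (Fin n) ℂ)
    (hx : x.PosSemidef) (hy : y.PosSemidef)
    (N : Matrix (Fin n) (Fin n) ℂ → ℝ)
    (hN_add : ∀ A B, N (A + B) ≤ N A + N B)
    (hN_smul : ∀ (c : ℂ) A, N (c • A) = ‖c‖ * N A)
    (hN_zero : ∀ A, N A = 0 ↔ A = 0)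
    (hN_unitary : ∀ (A U V : Matrix (Fin n) (Fin n) ℂ),
      U ∈ Matrix.unitaryGroup (Fin n) ℂ → V ∈ Matrix.unitaryGroup (Fin n) ℂ →
      N (U * A * V) = N A)
    (t : ℝ) (ht : t ∈ Set.Icc (1/2 : ℝ) 1) :
    N (psdPow x t * psdPow y (1 - t) + psdPow y t * psdPow x (1 - t)) ≤
      Real.sqrt (N (x + y)) *
        Real.sqrt (N (psdPow y (1 - t) * psdPow x (2*t - 1) * psdPow y (1 - t) +
          psdPow x (1 - t) * psdPow y (2*t - 1) * psdPow x (1 - t))) := by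
  have hN : IsUnitarilyInvariantNorm N := ⟨hN_add, hN_smul, hN_zero, hN_unitary⟩
  obtain ⟨ht₁, ht₂⟩ := ht
  have hhalf : (0 : ℝ) ≤ 1 / 2 := by norm_num
  have htm : 0 ≤ t - 1 / 2 := by linarith
  have hself : ∀ z : Matrix (Fin n) (Fin n) ℂ, z.PosSemidef →
      psdPow z (1 / 2) * psdPow z (1 / 2) = z := fun z hz => by
    rw [psdPow_mul_psdPow hz hhalf hhalf, add_halves, psdPow_one hz.isHermitian]
  have hpow : ∀ z : Matrix (Fin n) (Fin n) ℂ, z.PosSemidef →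
      psdPow z (1 / 2) * psdPow z (t - 1 / 2) = psdPow z t := fun z hz => by
    rw [psdPow_mul_psdPow hz hhalf htm, add_sub_cancel]
  have hsq : ∀ z : Matrix (Fin n) (Fin n) ℂ, z.PosSemidef →
      psdPow z (t - 1 / 2) * psdPow z (t - 1 / 2) = psdPow z (2 * t - 1) := fun z hz => by
    rw [psdPow_mul_psdPow hz htm htm]
    ring_nf
  have h := hN.conjTranspose_mul_le_sqrt
    (Matrix.fromRows (psdPow x (1 / 2)) (psdPow y (1 / 2)))
    (Matrix.fromRows (psdPow x (t - 1 / 2) * psdPow y (1 - t))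
      (psdPow y (t - 1 / 2) * psdPow x (1 - t)))
  simp only [Matrix.conjTranspose_fromRows_eq_fromCols_conjTranspose, Matrix.fromCols_mul_fromRows,
    Matrix.conjTranspose_mul, psdPow_conjTranspose, hself x hx, hself y hy] at h
  rw [← Matrix.mul_assoc (psdPow x (1 / 2)), ← Matrix.mul_assoc (psdPow y (1 / 2)),
    ← Matrix.mul_assoc _ (psdPow x (t - 1 / 2)), ← Matrix.mul_assoc _ (psdPow y (t - 1 / 2)),
    Matrix.mul_assoc _ (psdPow x (t - 1 / 2)) (psdPow x (t - 1 / 2)),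
    Matrix.mul_assoc _ (psdPow y (t - 1 / 2)) (psdPow y (t - 1 / 2)),
    hpow x hx, hpow y hy, hsq x hx, hsq y hy] at h
  exact h
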